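/- Let A = {a,b,c} be a set of three alternatives and let R be a preference profile on a finite electorate N. A lottery p is PC-efficient in R if it satisfies all of the following conditions: (1) p(x) = 0 for every alternative x that is Pareto-dominated in R; (2) for every alternative x that is bottom-ranked by no voter and top-ranked by at least one voter in R, there exists y ∈ A∖{x} with p(y) = 0; (3) p(x) = 0 for every alternative x that is top-ranked by no voter and bottom-ranked by at least one voter in R. -/

import Mathlib

open scoped Classical
open Finset

noncomputable section

/-- A strict preference relation: a strict linear (total) order on `A`. -/
abbrev Pref (A : Type*) : Type _ := {r : A → A → Prop // IsStrictTotalOrder A r}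

/-- A lottery over the finite set `A` of alternatives. -/
def Lottery (A : Type*) [Fintype A] : Type _ :=
  {p : A → ℝ // (∀ x, 0 ≤ p x) ∧ ∑ x : A, p x = 1}

variable {A : Type*} [Fintype A]

/-- `∑_{x ≻ y} p(x) q(y)`. -/
def PCsum (r : Pref A) (p q : A → ℝ) : ℝ :=
  ∑ x : A, ∑ y : A, if r.val x y then p x * q y else 0

/-- Pairwise-comparison (weak) preference over lotteries: `p ≿^PC q`. -/
def PCge (r : Pref A) (p q : Lottery A) : Prop :=
  PCsum r q.val p.val ≤ PCsum r p.val q.val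

/-- Pairwise-comparison strict preference over lotteries: `p ≻^PC q`. -/
def PCgt (r : Pref A) (p q : Lottery A) : Prop :=
  PCsum r q.val p.val < PCsum r p.val q.val

/-- `p` PC-dominates `q` in the profile `R`. -/
def PCDominates {I : Type*} (R : I → Pref A) (p q : Lottery A) : Prop :=
  (∀ i, PCge (R i) p q) ∧ (∃ i, PCgt (R i) p q)

/-- A lottery is PC-efficient in `R` if no lottery PC-dominates it. -/
def PCEfficientLottery {I : Type*} (R : I → Pref A) (p : Lottery A) : Prop :=
  ¬ ∃ q : Lottery A, PCDominates R q p

/-- `x` is the top-ranked (most preferred) alternative of `r`. -/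
def TopRanks (r : Pref A) (x : A) : Prop := ∀ y, y ≠ x → r.val x y

/-- `x` is the bottom-ranked (least preferred) alternative of `r`. -/
def BottomRanks (r : Pref A) (x : A) : Prop := ∀ y, y ≠ x → r.val y x

/-- Some voter ranks the alternatives in the order `x ≻ y ≻ z`. -/
def Occurs {A N : Type*} (R : N → Pref A) (x y z : A) : Prop :=
  ∃ i, (R i).val x y ∧ (R i).val y z

/-- The amount by which a voter with preferences `x ≻ y ≻ z` PC-prefers `q` to `p`. -/
def margin {A : Type*} (q p : A → ℝ) (x y z : A) : ℝ :=
  (q x * p y - p x * q y) + (q x * p z - p x * q z) + (q y * p z - p y * q z)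

/-- `a`, `b`, `c` are distinct and exhaust the set of alternatives. -/
structure Enumerates {A : Type*} (a b c : A) : Prop where
  ne_ab : a ≠ b
  ne_ac : a ≠ c
  ne_bc : b ≠ c
  cover : ∀ u, u = a ∨ u = b ∨ u = c

theorem Enumerates.rotate {A : Type*} {a b c : A} (h : Enumerates a b c) : Enumerates b c a :=
  ⟨h.ne_bc, h.ne_ab.symm, h.ne_ac.symm, fun u => by have := h.cover u; tauto⟩

theorem Enumerates.swap {A : Type*} {a b c : A} (h : Enumerates a b c) : Enumerates a c b :=
  ⟨h.ne_ac, h.ne_ab, h.ne_bc.symm, fun u => by have := h.cover u; tauto⟩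

theorem Enumerates.sum_eq {A : Type*} [Fintype A] {a b c : A} (h : Enumerates a b c)
    (f : A → ℝ) : ∑ x, f x = f a + f b + f c := by
  have hu : (univ : Finset A) = {a, b, c} := by
    ext u
    simpa using h.cover u
  have hab := h.ne_ab
  have hac := h.ne_ac
  have hbc := h.ne_bc
  rw [hu, sum_insert (by simp [hab, hac]), sum_insert (by simp [hbc]), sum_singleton]
  ring

namespace Pref

theorem irrefl {A : Type*} (r : Pref A) (x : A) : ¬ r.val x x :=
  r.property.irrefl x

theorem trans {A : Type*} (r : Pref A) {x y z : A} (hxy : r.val x y) (hyz : r.val y z) :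
    r.val x z :=
  r.property.trans x y z hxy hyz

theorem asymm {A : Type*} (r : Pref A) {x y : A} (hxy : r.val x y) : ¬ r.val y x :=
  fun hyx => r.irrefl x (r.trans hxy hyx)

theorem total {A : Type*} (r : Pref A) {x y : A} (hne : x ≠ y) : r.val x y ∨ r.val y x := by
  by_contra! hcon
  exact hne (r.property.trichotomous x y hcon.1 hcon.2)

theorem chain_cases {A : Type*} (r : Pref A) {a b c : A} (h : Enumerates a b c) :
    (r.val a b ∧ r.val b c) ∨ (r.val a c ∧ r.val c b) ∨ (r.val b a ∧ r.val a c) ∨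
      (r.val b c ∧ r.val c a) ∨ (r.val c a ∧ r.val a b) ∨ (r.val c b ∧ r.val b a) := by
  have hab := r.total h.ne_ab
  have hac := r.total h.ne_ac
  have hbc := r.total h.ne_bc
  tauto

theorem PCsum_sub_eq_margin {A : Type*} [Fintype A] (r : Pref A) {x y z : A}
    (h : Enumerates x y z) (hxy : r.val x y) (hyz : r.val y z) (q p : A → ℝ) :
    PCsum r q p - PCsum r p q = margin q p x y z := by
  have hxz := r.trans hxy hyz
  simp only [PCsum, h.sum_eq, margin, hxy, hyz, hxz, r.asymm hxy, r.asymm hyz, r.asymm hxz,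
    r.irrefl, if_true, if_false]
  ring

theorem topRanks_iff {A : Type*} (r : Pref A) {x y z : A} (h : Enumerates x y z) :
    TopRanks r x ↔ (r.val x y ∧ r.val y z) ∨ (r.val x z ∧ r.val z y) := by
  constructor
  · intro ht
    have hxy := ht y h.ne_ab.symm
    have hxz := ht z h.ne_ac.symm
    have hyz := r.total h.ne_bc
    tauto
  · rintro hr u hu
    rcases h.cover u with rfl | rfl | rfl
    · exact absurd rfl hu
    · exact hr.elim (fun hc => hc.1) (fun hc => r.trans hc.1 hc.2)
    · exact hr.elim (fun hc => r.trans hc.1 hc.2) (fun hc => hc.1)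

theorem bottomRanks_iff {A : Type*} (r : Pref A) {x y z : A} (h : Enumerates x y z) :
    BottomRanks r x ↔ (r.val y z ∧ r.val z x) ∨ (r.val z y ∧ r.val y x) := by
  constructor
  · intro ht
    have hyx := ht y h.ne_ab.symm
    have hzx := ht z h.ne_ac.symm
    have hyz := r.total h.ne_bc
    tauto
  · rintro hr u hu
    rcases h.cover u with rfl | rfl | rfl
    · exact absurd rfl hu
    · exact hr.elim (fun hc => r.trans hc.1 hc.2) (fun hc => hc.2)
    · exact hr.elim (fun hc => hc.2) (fun hc => r.trans hc.1 hc.2)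

end Pref

theorem exists_topRanks_iff {A N : Type*} (R : N → Pref A) {x y z : A} (h : Enumerates x y z) :
    (∃ i, TopRanks (R i) x) ↔ Occurs R x y z ∨ Occurs R x z y := by
  simp only [Occurs, ← exists_or, (R _).topRanks_iff h]

theorem exists_bottomRanks_iff {A N : Type*} (R : N → Pref A) {x y z : A}
    (h : Enumerates x y z) :
    (∃ i, BottomRanks (R i) x) ↔ Occurs R y z x ∨ Occurs R z y x := by
  simp only [Occurs, ← exists_or, (R _).bottomRanks_iff h]

/-- `p` satisfies the three sufficient conditions and every voter weakly PC-prefers `q` to `p`,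
expressed through the orders of the alternatives that occur in the profile. -/
structure WeaklyDominated {A N : Type*} (R : N → Pref A) (q p : A → ℝ) : Prop where
  nonneg_left : ∀ x, 0 ≤ q x
  nonneg_right : ∀ x, 0 ≤ p x
  sum_right : ∀ x y z, Enumerates x y z → p x + p y + p z = 1
  undominated : ∀ x y z, Enumerates x y z → 0 < p x →
    Occurs R x y z ∨ Occurs R x z y ∨ Occurs R z x y
  bottom_of_top : ∀ x y z, Enumerates x y z → 0 < p y → 0 < p z →
    (Occurs R x y z ∨ Occurs R x z y) → (Occurs R y z x ∨ Occurs R z y x)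
  top_of_bottom : ∀ x y z, Enumerates x y z → 0 < p x →
    (Occurs R y z x ∨ Occurs R z y x) → (Occurs R x y z ∨ Occurs R x z y)
  margin_nonneg : ∀ x y z, Enumerates x y z → Occurs R x y z → 0 ≤ margin q p x y z

namespace WeaklyDominated

variable {A N : Type*} {R : N → Pref A} {q p : A → ℝ} {a b c : A}

/-- No voter whose preferences order `a`, `b`, `c` in any way strictly PC-prefers `q` to `p`. -/
def NoStrict {A N : Type*} (R : N → Pref A) (q p : A → ℝ) (a b c : A) : Prop :=
  (Occurs R a b c → margin q p a b c ≤ 0) ∧ (Occurs R a c b → margin q p a c b ≤ 0) ∧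
  (Occurs R b a c → margin q p b a c ≤ 0) ∧ (Occurs R b c a → margin q p b c a ≤ 0) ∧
  (Occurs R c a b → margin q p c a b ≤ 0) ∧ (Occurs R c b a → margin q p c b a ≤ 0)

theorem noStrict_of_single (h : WeaklyDominated R q p) (e : Enumerates a b c)
    (ha : 0 < p a) (hb : p b = 0) (hc : p c = 0) : NoStrict R q p a b c := by
  have hpa : p a = 1 := by linarith [h.sum_right a b c e]
  have hqb := h.nonneg_left b
  have hqc := h.nonneg_left c
  have U1 := h.undominated a b c e ha
  have U2 := h.undominated a c b e.swap ha
  have T := h.top_of_bottom a b c e ha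
  have M1 := h.margin_nonneg a b c e
  have M2 := h.margin_nonneg a c b e.swap
  have M3 := h.margin_nonneg b a c e.rotate.swap
  have M5 := h.margin_nonneg c a b e.rotate.rotate
  simp only [NoStrict, margin, hpa, hb, hc] at *
  by_cases ht : Occurs R a b c ∨ Occurs R a c b
  · have hqb0 : q b = 0 := by rcases ht with ht | ht <;> [have := M1 ht; have := M2 ht] <;> linarith
    have hqc0 : q c = 0 := by rcases ht with ht | ht <;> [have := M1 ht; have := M2 ht] <;> linarith
    simp [hqb0, hqc0]
  · have k3 := M3 (by grind)
    have k5 := M5 (by grind)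
    refine ⟨by grind, by grind, fun _ => by linarith, by grind, fun _ => by linarith, by grind⟩

theorem noStrict_of_pair (h : WeaklyDominated R q p) (e : Enumerates a b c)
    (ha : p a = 0) (hb : 0 < p b) (hc : 0 < p c) : NoStrict R q p a b c := by
  have hpc : p c = 1 - p b := by linarith [h.sum_right a b c e]
  rw [hpc] at hc
  have hqa := h.nonneg_left a
  have Ub := h.undominated b c a e.rotate hb
  have Uc := h.undominated c b a e.rotate.rotate.swap (hpc ▸ hc)
  have Ba := h.bottom_of_top a b c e hb (hpc ▸ hc)
  have Tb := h.top_of_bottom b a c e.rotate.swap hb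
  have Tc := h.top_of_bottom c a b e.rotate.rotate (hpc ▸ hc)
  have M1 := h.margin_nonneg a b c e
  have M2 := h.margin_nonneg a c b e.swap
  have M3 := h.margin_nonneg b a c e.rotate.swap
  have M4 := h.margin_nonneg b c a e.rotate
  have M5 := h.margin_nonneg c a b e.rotate.rotate
  have M6 := h.margin_nonneg c b a e.rotate.rotate.swap
  rcases hqa.eq_or_lt with hq0 | hqpos
  · simp only [NoStrict, margin, hpc, ha, ← hq0] at *
    have hV : q b * (1 - p b) - p b * q c = 0 := by
      apply le_antisymm
      · rcases Uc with k | k | k <;> [have := M6 k; have := M5 k; have := M2 k] <;> linarith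
      · rcases Ub with k | k | k <;> [have := M4 k; have := M3 k; have := M1 k] <;> linarith
    refine ⟨?_, ?_, ?_, ?_, ?_, ?_⟩ <;> intro _ <;> linarith
  · have t1 : 0 < q a * p b := by positivity
    have t2 : 0 < q a * (1 - p b) := by positivity
    simp only [NoStrict, margin, hpc, ha] at *
    by_cases k4 : Occurs R b c a
    · have m4 := M4 k4
      have n6 : ¬ Occurs R c b a := fun k => by have := M6 k; linarith
      have n5 : ¬ Occurs R c a b := fun k => by have := M5 k; linarith
      have k2 : Occurs R a c b := by grind
      have m2 := M2 k2
      exact ⟨by grind, fun _ => by linarith, by grind, fun _ => by linarith, by grind, by grind⟩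
    by_cases k6 : Occurs R c b a
    · have m6 := M6 k6
      have n3 : ¬ Occurs R b a c := fun k => by have := M3 k; linarith
      have k1 : Occurs R a b c := by grind
      have m1 := M1 k1
      exact ⟨fun _ => by linarith, by grind, by grind, by grind, by grind, fun _ => by linarith⟩
    · have m3 := M3 (by grind)
      have m5 := M5 (by grind)
      exact ⟨by grind, by grind, fun _ => by linarith, by grind, fun _ => by linarith, by grind⟩

theorem noStrict_of_full (h : WeaklyDominated R q p) (e : Enumerates a b c)
    (ha : 0 < p a) (hb : 0 < p b) (hc : 0 < p c) : NoStrict R q p a b c := by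
  have Ba := h.bottom_of_top a b c e hb hc
  have Bb := h.bottom_of_top b a c e.rotate.swap ha hc
  have Bc := h.bottom_of_top c a b e.rotate.rotate ha hb
  have Ta := h.top_of_bottom a b c e ha
  have Tb := h.top_of_bottom b a c e.rotate.swap hb
  have Tc := h.top_of_bottom c a b e.rotate.rotate hc
  have M1 := h.margin_nonneg a b c e
  have M2 := h.margin_nonneg a c b e.swap
  have M3 := h.margin_nonneg b a c e.rotate.swap
  have M4 := h.margin_nonneg b c a e.rotate
  have M5 := h.margin_nonneg c a b e.rotate.rotate
  have M6 := h.margin_nonneg c b a e.rotate.rotate.swap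
  have plane : p c * (q a * p b - p a * q b) + p a * (q b * p c - p b * q c)
      - p b * (q a * p c - p a * q c) = 0 := by ring
  have swap_pair : ∀ x y : A, q x * p y - p x * q y = -(q y * p x - p y * q x) := by
    intros; ring
  simp only [NoStrict, margin, swap_pair b a, swap_pair c a, swap_pair c b] at *
  generalize q a * p b - p a * q b = U at *
  generalize q b * p c - p b * q c = V at *
  generalize q a * p c - p a * q c = W at *
  generalize Occurs R a b c = P1 at *
  generalize Occurs R a c b = P2 at *
  generalize Occurs R b a c = P3 at *
  generalize Occurs R b c a = P4 at *
  generalize Occurs R c a b = P5 at *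
  generalize Occurs R c b a = P6 at *
  have zero_of_signs : 0 ≤ p c * U → 0 ≤ p a * V → 0 ≤ -(p b * W) → U = 0 ∧ V = 0 ∧ W = 0 := by
    intro hU hV hW
    have eU : p c * U = 0 := by linarith
    have eV : p a * V = 0 := by linarith
    have eW : p b * W = 0 := by linarith
    simpa [ha.ne', hb.ne', hc.ne'] using And.intro eU (And.intro eV eW)
  have pos_triangle : P1 ∧ P4 ∧ P5 → U = 0 ∧ V = 0 ∧ W = 0 := by
    rintro ⟨k1, k4, k5⟩
    have m1 := M1 k1
    have m4 := M4 k4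
    have m5 := M5 k5
    refine zero_of_signs (mul_nonneg hc.le (by linarith)) (mul_nonneg ha.le (by linarith)) ?_
    rw [← mul_neg]
    exact mul_nonneg hb.le (by linarith)
  have neg_triangle : P2 ∧ P3 ∧ P6 → U = 0 ∧ V = 0 ∧ W = 0 := by
    rintro ⟨k2, k3, k6⟩
    have m2 := M2 k2
    have m3 := M3 k3
    have m6 := M6 k6
    have hU := mul_nonneg hc.le (show 0 ≤ -U by linarith)
    have hV := mul_nonneg ha.le (show 0 ≤ -V by linarith)
    have hW := mul_nonneg hb.le (show 0 ≤ W by linarith)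
    rw [mul_neg] at hU hV
    exact zero_of_signs (by linarith) (by linarith) (by linarith)
  have ab_opposite : (P1 ∧ P6) ∧ (P3 ∧ P5) → U = 0 ∧ V = 0 ∧ W = 0 := by
    rintro ⟨⟨k1, k6⟩, k3, k5⟩
    have m1 := M1 k1
    have m6 := M6 k6
    have m3 := M3 k3
    have m5 := M5 k5
    have hU : U = 0 := by linarith
    have hW : W = -V := by linarith
    subst hU hW
    have hV : V = 0 := by
      have : (p a + p b) * V = 0 := by linarith
      exact (mul_eq_zero.mp this).resolve_left (by positivity)
    simp [hV]
  have bc_opposite : (P1 ∧ P6) ∧ (P2 ∧ P4) → U = 0 ∧ V = 0 ∧ W = 0 := by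
    rintro ⟨⟨k1, k6⟩, k2, k4⟩
    have m1 := M1 k1
    have m6 := M6 k6
    have m2 := M2 k2
    have m4 := M4 k4
    have hV : V = 0 := by linarith
    have hW : W = -U := by linarith
    subst hV hW
    have hU : U = 0 := by
      have : (p c + p b) * U = 0 := by linarith
      exact (mul_eq_zero.mp this).resolve_left (by positivity)
    simp [hU]
  have ac_opposite : (P2 ∧ P4) ∧ (P3 ∧ P5) → U = 0 ∧ V = 0 ∧ W = 0 := by
    rintro ⟨⟨k2, k4⟩, k3, k5⟩
    have m2 := M2 k2
    have m4 := M4 k4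
    have m3 := M3 k3
    have m5 := M5 k5
    have hW : W = 0 := by linarith
    have hV : V = U := by linarith
    subst hV hW
    have hU : V = 0 := by
      have : (p c + p a) * V = 0 := by linarith
      exact (mul_eq_zero.mp this).resolve_left (by positivity)
    simp [hU]
  by_cases hzero : U = 0 ∧ V = 0 ∧ W = 0
  · obtain ⟨rfl, rfl, rfl⟩ := hzero
    simp
  · simp only [hzero, imp_false] at pos_triangle neg_triangle ab_opposite bc_opposite ac_opposite
    clear hzero zero_of_signs plane
    have r1 : P1 → P6 := by grind only
    have r6 : P6 → P1 := by grind only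
    have r2 : P2 → P4 := by grind only
    have r4 : P4 → P2 := by grind only
    have r3 : P3 → P5 := by grind only
    have r5 : P5 → P3 := by grind only
    exact ⟨fun k => by linarith [M6 (r1 k)], fun k => by linarith [M4 (r2 k)],
      fun k => by linarith [M5 (r3 k)], fun k => by linarith [M2 (r4 k)],
      fun k => by linarith [M3 (r5 k)], fun k => by linarith [M1 (r6 k)]⟩

theorem noStrict (h : WeaklyDominated R q p) (e : Enumerates a b c) : NoStrict R q p a b c := by
  have hs := h.sum_right a b c e
  rcases (h.nonneg_right a).eq_or_lt with ha | ha <;>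
    rcases (h.nonneg_right b).eq_or_lt with hb | hb <;>
    rcases (h.nonneg_right c).eq_or_lt with hc | hc
  · linarith
  · have := h.noStrict_of_single e.rotate.rotate hc ha.symm hb.symm
    unfold NoStrict at *
    tauto
  · have := h.noStrict_of_single e.rotate hb hc.symm ha.symm
    unfold NoStrict at *
    tauto
  · exact h.noStrict_of_pair e ha.symm hb hc
  · exact h.noStrict_of_single e ha hb.symm hc.symm
  · have := h.noStrict_of_pair e.rotate hb.symm hc ha
    unfold NoStrict at *
    tauto
  · have := h.noStrict_of_pair e.rotate.rotate hc.symm ha hb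
    unfold NoStrict at *
    tauto
  · exact h.noStrict_of_full e ha hb hc

end WeaklyDominated

/-- For `A = {a,b,c}`, a lottery satisfying the three conditions is
PC-efficient: (1) Pareto-dominated alternatives get probability 0; (2) if some alternative
is never bottom-ranked and at least once top-ranked, some other alternative gets
probability 0; (3) alternatives that are never top-ranked but at least once bottom-ranked
get probability 0. -/
theorem pc_efficiency_sufficient_conditions_three_alternatives
    {A N : Type*} [Fintype A] [Fintype N]
    (a b c : A) (hab : a ≠ b) (hac : a ≠ c) (hbc : b ≠ c)
    (hcover : ∀ u : A, u = a ∨ u = b ∨ u = c)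
    (R : N → Pref A) (p : Lottery A)
    (h1 : ∀ x : A, (∃ y : A, ∀ i : N, (R i).val y x) → p.val x = 0)
    (h2 : ∀ x : A, (∀ i : N, ¬ BottomRanks (R i) x) → (∃ i : N, TopRanks (R i) x) →
      ∃ y : A, y ≠ x ∧ p.val y = 0)
    (h3 : ∀ x : A, (∀ i : N, ¬ TopRanks (R i) x) → (∃ i : N, BottomRanks (R i) x) →
      p.val x = 0) :
    PCEfficientLottery R p := by
  rintro ⟨q, hge, i, hgt⟩
  have e : Enumerates a b c := ⟨hab, hac, hbc, hcover⟩
  have hw : WeaklyDominated R q.val p.val :=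
    { nonneg_left := q.property.1
      nonneg_right := p.property.1
      sum_right := fun x y z e' => by rw [← e'.sum_eq]; exact p.property.2
      undominated := fun x y z e' hx => by
        by_contra hno
        refine hx.ne' (h1 x ⟨y, fun j => ?_⟩)
        refine ((R j).total e'.ne_ab).resolve_left fun hxy => hno ?_
        rcases (R j).chain_cases e' with k | k | k | k | k | k
        · exact Or.inl ⟨j, k⟩
        · exact Or.inr (Or.inl ⟨j, k⟩)
        · exact absurd k.1 ((R j).asymm hxy)
        · exact absurd ((R j).trans k.1 k.2) ((R j).asymm hxy)
        · exact Or.inr (Or.inr ⟨j, k⟩)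
        · exact absurd k.2 ((R j).asymm hxy)
      bottom_of_top := fun x y z e' hy hz ht => by
        rw [← exists_bottomRanks_iff R e']
        by_contra! hno
        obtain ⟨u, hu, hpu⟩ := h2 x hno ((exists_topRanks_iff R e').mpr ht)
        rcases e'.cover u with rfl | rfl | rfl
        · exact hu rfl
        · exact hy.ne' hpu
        · exact hz.ne' hpu
      top_of_bottom := fun x y z e' hx hbot => by
        rw [← exists_topRanks_iff R e']
        by_contra! hno
        exact hx.ne' (h3 x hno ((exists_bottomRanks_iff R e').mpr hbot))
      margin_nonneg := fun x y z e' ⟨j, hxy, hyz⟩ => by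
        rw [← (R j).PCsum_sub_eq_margin e' hxy hyz]
        exact sub_nonneg.mpr (hge j) }
  have strict : ∀ x y z, Enumerates x y z → (R i).val x y ∧ (R i).val y z →
      ¬ (Occurs R x y z → margin q.val p.val x y z ≤ 0) := by
    intro x y z e' hr hle
    have hm := hle ⟨i, hr⟩
    rw [← (R i).PCsum_sub_eq_margin e' hr.1 hr.2] at hm
    exact absurd hgt (not_lt.mpr (sub_nonpos.mp hm))
  obtain ⟨n1, n2, n3, n4, n5, n6⟩ := hw.noStrict e
  rcases (R i).chain_cases e with k | k | k | k | k | k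
  · exact strict a b c e k n1
  · exact strict a c b e.swap k n2
  · exact strict b a c e.rotate.swap k n3
  · exact strict b c a e.rotate k n4
  · exact strict c a b e.rotate.rotate k n5
  · exact strict c b a e.rotate.rotate.swap k n6

end
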